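/- Let b be an invertible H-invariant element of B (b◁ω = ε(ω)b for all ω ∈ H). Then the automorphism Ad b : c ↦ b c b^{-1} of B induces the identity map on the equivariant cyclic cohomology HC^•_H(B). -/

import Mathlib

open scoped TensorProduct

noncomputable section

/-- A Hopf `ℂ`-algebra with invertible antipode, together with a chosen finite
(Sweedler) representation of the comultiplication: `Δ ω = ∑_{p ∈ Δl ω} p.1 ⊗ p.2`. -/
structure HopfData (H : Type) [Ring H] [HopfAlgebra ℂ H] where
  /-- the inverse of the antipode -/
  Sinv : H →ₗ[ℂ] H
  Sinv_antipode : ∀ ω : H, Sinv (HopfAlgebra.antipode (R := ℂ) ω) = ω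
  antipode_Sinv : ∀ ω : H, HopfAlgebra.antipode (R := ℂ) (Sinv ω) = ω
  /-- a chosen list representation of the comultiplication -/
  Δl : H → List (H × H)
  Δl_repr : ∀ ω : H,
    (Coalgebra.comul (R := ℂ) ω : H ⊗[ℂ] H) = ((Δl ω).map fun p => p.1 ⊗ₜ[ℂ] p.2).sum

variable {H : Type} [Ring H] [HopfAlgebra ℂ H]

/-- the counit, as a `ℂ`-valued function -/
def epsi (ω : H) : ℂ := Coalgebra.counit (R := ℂ) ω

/-- Iterated Sweedler decomposition: `sw n ω` represents
`Δⁿ ω = ∑_v v 0 ⊗ ⋯ ⊗ v n`, where `Δⁿ = (ι ⊗ Δ) Δ^{n-1}`. -/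
def HopfData.sw (D : HopfData H) : (n : ℕ) → H → List (Fin (n + 1) → H)
  | 0, ω => [fun _ => ω]
  | n + 1, ω =>
    (D.sw n ω).flatMap fun v =>
      (D.Δl (v (Fin.last n))).map fun p =>
        Fin.snoc (Function.update v (Fin.last n) p.1) p.2

/-- A right `H`-module structure (over `ℂ`), recorded as the antihomomorphism
`act : H → End(B)`, so `act ω b` stands for `b ◁ ω`. -/
structure RAct (H : Type) [Ring H] [HopfAlgebra ℂ H] (B : Type) [AddCommGroup B]
    [Module ℂ B] where
  act : H →ₗ[ℂ] B →ₗ[ℂ] B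
  act_one : act 1 = LinearMap.id
  act_mul : ∀ ω η : H, act (ω * η) = (act η) ∘ₗ (act ω)

/-- A unital right `H`-module algebra structure on `B`:
`(b₁ b₂) ◁ ω = ∑ (b₁ ◁ ω₍₀₎)(b₂ ◁ ω₍₁₎)` and `1 ◁ ω = ε(ω) 1`. -/
structure MAlg (D : HopfData H) (B : Type) [Ring B] [Algebra ℂ B] extends RAct H B where
  act_mul_mul : ∀ (ω : H) (b₁ b₂ : B),
    act ω (b₁ * b₂) = ((D.Δl ω).map fun p => act p.1 b₁ * act p.2 b₂).sum
  act_algOne : ∀ ω : H, act ω (1 : B) = epsi ω • (1 : B)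


/-- the action as a plain function: `fn ω b = b ◁ ω` -/
def RAct.fn {H : Type} [Ring H] [HopfAlgebra ℂ H] {B : Type} [AddCommGroup B] [Module ℂ B]
    (A : RAct H B) : H → B → B := fun ω x => A.act ω x

/-- the action of a module algebra as a plain function -/
def MAlg.fn {H : Type} [Ring H] [HopfAlgebra ℂ H] {B : Type} [Ring B] [Algebra ℂ B]
    {D : HopfData H} (A : MAlg D B) : H → B → B := A.toRAct.fn

/-- The space of `ℂ`-valued functions of one `H`-variable and `n+1` `B`-variables;
(multi)linear such functions correspond to linear functionals on `H ⊗ B^{⊗(n+1)}`. -/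
abbrev Raw (H B : Type) (n : ℕ) := H → (Fin (n + 1) → B) → ℂ

section Raw

variable {H : Type} [Ring H] [HopfAlgebra ℂ H] {B : Type} [Ring B] [Algebra ℂ B] {n : ℕ}

/-- `f` is linear in the `H`-variable and in each `B`-variable separately, i.e. `f`
is (the restriction of) a linear functional on `H ⊗ B^{⊗(n+1)}`. -/
def IsML (f : Raw H B n) : Prop :=
  (∀ ω η b, f (ω + η) b = f ω b + f η b) ∧
  (∀ (c : ℂ) ω b, f (c • ω) b = c * f ω b) ∧
  (∀ ω b (i : Fin (n + 1)) (x y : B),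
    f ω (Function.update b i (x + y)) =
      f ω (Function.update b i x) + f ω (Function.update b i y)) ∧
  (∀ ω b (i : Fin (n + 1)) (c : ℂ) (x : B),
    f ω (Function.update b i (c • x)) = c * f ω (Function.update b i x))

/-- `H`-invariance of the functional `f` on `H ⊗ B^{⊗(n+1)}`:
`(ω ▷ f)(η ⊗ b₀ ⊗ ⋯ ⊗ bₙ) = f(S⁻¹(ω₍₀₎) η ω₍₁₎ ⊗ b₀ ◁ ω₍₂₎ ⊗ ⋯ ⊗ bₙ ◁ ω₍ₙ₊₂₎)`
equals `ε(ω) f(η ⊗ b₀ ⊗ ⋯ ⊗ bₙ)`. -/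
def IsInv (D : HopfData H) (act : H → B → B) (f : Raw H B n) : Prop :=
  ∀ (ω η : H) (b : Fin (n + 1) → B),
    ((D.sw (n + 2) ω).map fun v =>
        f (D.Sinv (v 0) * η * v 1) fun i => act (v i.succ.succ) (b i)).sum
      = epsi ω * f η b

/-- membership in the equivariant cochain space `C^n_H(B)` -/
def InC (D : HopfData H) (act : H → B → B) (f : Raw H B n) : Prop :=
  IsML f ∧ IsInv D act f

/-- the cyclic operator
`(tₙ f)(ω ⊗ b₀ ⊗ ⋯ ⊗ bₙ) = f(ω₍₀₎ ⊗ bₙ ◁ ω₍₁₎ ⊗ b₀ ⊗ ⋯ ⊗ b_{n-1})` -/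
def tRaw (D : HopfData H) (act : H → B → B) (f : Raw H B n) : Raw H B n :=
  fun ω b =>
    ((D.Δl ω).map fun p =>
      f p.1 (Fin.cons (act p.2 (b (Fin.last n))) fun i : Fin n => b i.castSucc)).sum

/-- merging the `i`-th and `(i+1)`-st entries of a `(n+2)`-tuple by multiplication -/
def contract (i : Fin (n + 1)) (b : Fin (n + 2) → B) : Fin (n + 1) → B :=
  fun j =>
    if (j : ℕ) < (i : ℕ) then b j.castSucc
    else if (j : ℕ) = (i : ℕ) then b j.castSucc * b j.succ
    else b j.succ

/-- the coface operators `dⁿᵢ : C^{n} → C^{n+1}` (`i < n+1` multiplies adjacent entries;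
the last one is `d_{n+1} = t ∘ d₀`) -/
def dRaw (D : HopfData H) (act : H → B → B) (i : Fin (n + 2)) (f : Raw H B n) :
    Raw H B (n + 1) :=
  if h : (i : ℕ) < n + 1 then fun ω b => f ω (contract ⟨i, h⟩ b)
  else tRaw D act fun ω b => f ω (contract 0 b)

/-- the codegeneracy operators `sⁿᵢ : C^{n+1} → C^n`, inserting a `1` after the `i`-th entry -/
def sRaw (i : Fin (n + 1)) (f : Raw H B (n + 1)) : Raw H B n :=
  fun ω b => f ω (Fin.insertNth i.succ 1 b)

/-- the Hochschild coboundary `b = ∑ (-1)ⁱ dᵢ` -/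
def bRaw (D : HopfData H) (act : H → B → B) (f : Raw H B n) : Raw H B (n + 1) :=
  fun ω b => ∑ i : Fin (n + 2), ((-1 : ℂ) ^ (i : ℕ)) * dRaw D act i f ω b

/-- cyclicity: `λ f = (-1)ⁿ tₙ f = f` -/
def IsCyc (D : HopfData H) (act : H → B → B) (f : Raw H B n) : Prop :=
  ∀ ω b, ((-1 : ℂ) ^ n) * tRaw D act f ω b = f ω b

/-- an `n`-cocycle of the cyclic complex `(Ker(1-λ), b)` computing `HC^n_H(B)` -/
def IsCocycle (D : HopfData H) (act : H → B → B) (f : Raw H B n) : Prop :=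
  InC D act f ∧ IsCyc D act f ∧ ∀ ω b, bRaw D act f ω b = 0

end Raw

/-- the pullback of a cochain along the inner automorphism `Ad u : c ↦ u c u⁻¹` -/
def adPull {H B : Type} (u u' : B) [Ring B] {n : ℕ} (f : Raw H B n) : Raw H B n :=
  fun ω b => f ω fun i => u * b i * u'

set_option linter.unusedSectionVars false
set_option linter.unusedSimpArgs false


section HopfPart

theorem list_sum_finset {α ι M : Type*} [AddCommMonoid M] (l : List α) (s : Finset ι)
    (F : α → ι → M) :
    (l.map fun a => ∑ i ∈ s, F a i).sum = ∑ i ∈ s, (l.map fun a => F a i).sum := by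
  induction l with
  | nil => simp
  | cons a l ih => simp [ih, Finset.sum_add_distrib]

theorem list_sum_congr {α M : Type*} [AddCommMonoid M] (l : List α)
    {F G : α → M} (h : ∀ a, F a = G a) : (l.map F).sum = (l.map G).sum := by
  rw [funext h]

theorem list_sum_add {α M : Type*} [AddCommMonoid M] (l : List α)
    (F G : α → M) : (l.map fun a => F a + G a).sum = (l.map F).sum + (l.map G).sum := by
  induction l with
  | nil => simp
  | cons a l ih => simp [ih]; abel

theorem list_sum_mul {α : Type*} (l : List α) (c : ℂ)
    (F : α → ℂ) : (l.map fun a => c * F a).sum = c * (l.map F).sum :=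
  List.sum_map_mul_left ..

theorem list_sum_linear {α M N : Type*} [AddCommMonoid M] [AddCommMonoid N] (φ : M →+ N)
    (l : List α) (F : α → M) : φ (l.map F).sum = (l.map fun a => φ (F a)).sum := by
  induction l with
  | nil => simp
  | cons a l ih => simp [ih]

/-- Sweedler sums of bilinear expressions depend only on the comultiplication. -/
theorem sumDelta (D : HopfData H) {M : Type*} [AddCommGroup M] [Module ℂ M]
    (β : H →ₗ[ℂ] H →ₗ[ℂ] M) (ω : H) :
    ((D.Δl ω).map fun p => β p.1 p.2).sum
      = TensorProduct.lift β (Coalgebra.comul (R := ℂ) ω) := by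
  rw [D.Δl_repr]
  have h := list_sum_linear (TensorProduct.lift β).toAddMonoidHom (D.Δl ω)
    (fun p => p.1 ⊗ₜ[ℂ] p.2)
  simp only [LinearMap.toAddMonoidHom_coe, TensorProduct.lift.tmul] at h
  exact h.symm

theorem counit_left (D : HopfData H) {M : Type*} [AddCommGroup M] [Module ℂ M]
    (φ : H →ₗ[ℂ] M) (ω : H) :
    ((D.Δl ω).map fun p => epsi p.1 • φ p.2).sum = φ ω := by
  have h := sumDelta D
    ((LinearMap.lsmul ℂ M).compl₁₂ (Coalgebra.counit (R := ℂ) (A := H)) φ) ω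
  simp only [LinearMap.compl₁₂_apply, LinearMap.lsmul_apply] at h
  refine h.trans ?_
  have h2 := congrArg (TensorProduct.lift ((LinearMap.lsmul ℂ M).compl₂ φ))
    (Coalgebra.rTensor_counit_comul (R := ℂ) ω)
  simp only [TensorProduct.lift.tmul, LinearMap.compl₂_apply, LinearMap.lsmul_apply,
    one_smul] at h2
  have h3 : TensorProduct.lift
      ((LinearMap.lsmul ℂ M).compl₁₂ (Coalgebra.counit (R := ℂ) (A := H)) φ)
      = TensorProduct.lift ((LinearMap.lsmul ℂ M).compl₂ φ) ∘ₗ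
        (Coalgebra.counit (R := ℂ) (A := H)).rTensor H := by
    ext a b
    simp
  rw [h3, LinearMap.comp_apply]
  exact h2

theorem counit_right (D : HopfData H) {M : Type*} [AddCommGroup M] [Module ℂ M]
    (φ : H →ₗ[ℂ] M) (ω : H) :
    ((D.Δl ω).map fun p => epsi p.2 • φ p.1).sum = φ ω := by
  have h := sumDelta D
    ((LinearMap.lsmul ℂ M).compl₁₂ (Coalgebra.counit (R := ℂ) (A := H)) φ).flip ω
  simp only [LinearMap.flip_apply, LinearMap.compl₁₂_apply, LinearMap.lsmul_apply] at h
  refine h.trans ?_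
  have h2 := congrArg (TensorProduct.lift ((LinearMap.lsmul ℂ M).compl₂ φ).flip)
    (Coalgebra.lTensor_counit_comul (R := ℂ) ω)
  simp only [TensorProduct.lift.tmul, LinearMap.flip_apply, LinearMap.compl₂_apply,
    LinearMap.lsmul_apply, one_smul] at h2
  have h3 : TensorProduct.lift
      ((LinearMap.lsmul ℂ M).compl₁₂ (Coalgebra.counit (R := ℂ) (A := H)) φ).flip
      = TensorProduct.lift ((LinearMap.lsmul ℂ M).compl₂ φ).flip ∘ₗ
        (Coalgebra.counit (R := ℂ) (A := H)).lTensor H := by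
    ext a b
    simp
  rw [h3, LinearMap.comp_apply]
  exact h2

/-- head recursion for the iterated Sweedler decomposition -/
theorem sw_head (D : HopfData H) (n : ℕ) (ω : H) :
    D.sw (n + 1) ω = (D.Δl ω).flatMap fun p =>
      (D.sw n p.2).map fun v => (Fin.cons p.1 v : Fin (n + 2) → H) := by
  induction n generalizing ω with
  | zero =>
    simp only [HopfData.sw, List.flatMap_cons, List.flatMap_nil, List.append_nil, List.map_cons,
      List.map_nil]
    rw [← List.map_eq_flatMap]
    apply List.map_congr_left
    intro p _
    funext i
    fin_cases i
    · simp [Fin.snoc, Function.update]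
    · simp [Fin.snoc, Function.update]
  | succ n ih =>
    rw [HopfData.sw, ih, List.flatMap_assoc]
    congr 1
    funext p
    rw [HopfData.sw, List.flatMap_map, List.map_flatMap]
    congr 1
    funext v
    rw [List.map_map]
    have h : (Fin.cons p.1 v : Fin (n + 2) → H) (Fin.last (n + 1)) = v (Fin.last n) := by
      rw [← Fin.succ_last, Fin.cons_succ]
    rw [h]
    apply List.map_congr_left
    intro q _
    simp only [Function.comp]
    rw [Fin.cons_snoc_eq_snoc_cons, ← Fin.succ_last, Fin.cons_update]

theorem sw_sum_head (D : HopfData H) (n : ℕ) (ω : H) {M : Type*} [AddCommMonoid M]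
    (G : (Fin (n + 2) → H) → M) :
    ((D.sw (n + 1) ω).map G).sum
      = ((D.Δl ω).map fun p => ((D.sw n p.2).map fun v => G (Fin.cons p.1 v)).sum).sum := by
  rw [sw_head]
  induction D.Δl ω with
  | nil => simp
  | cons a l ih => simp [ih, Function.comp_def]

/-- the sum over the iterated Sweedler decomposition of a multilinear expression is linear -/
theorem sw_sum_linear (D : HopfData H) (n : ℕ) :
    ∃ Φ : MultilinearMap ℂ (fun _ : Fin (n + 1) => H) ℂ →ₗ[ℂ] H →ₗ[ℂ] ℂ,
      ∀ G ω, ((D.sw n ω).map fun v => G v).sum = Φ G ω := by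
  induction n with
  | zero =>
    refine ⟨LinearMap.mk₂ ℂ (fun G ω => G fun _ => ω) ?_ ?_ ?_ ?_, ?_⟩
    · intros; simp
    · intros; simp
    · intro G a b
      have := G.map_update_add (fun _ => a) 0 a b
      have e : ∀ c, Function.update (fun _ : Fin (0 + 1) => a) 0 c = fun _ => c := by
        intro c; funext i; fin_cases i; simp
      simpa only [e] using this
    · intro c G a
      have := G.map_update_smul (fun _ => a) 0 c a
      have e : ∀ c, Function.update (fun _ : Fin (0 + 1) => a) 0 c = fun _ => c := by
        intro c; funext i; fin_cases i; simp
      simpa only [e] using this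
    · intro G ω
      simp [HopfData.sw]
  | succ n ih =>
    obtain ⟨Φ, hΦ⟩ := ih
    refine ⟨LinearMap.mk₂ ℂ (fun G ω =>
      TensorProduct.lift (Φ ∘ₗ G.curryLeft) (Coalgebra.comul (R := ℂ) ω)) ?_ ?_ ?_ ?_, ?_⟩
    · intro G G' ω
      rw [← LinearMap.add_apply]
      congr 1
      ext a b
      have : (G + G').curryLeft a = G.curryLeft a + G'.curryLeft a := rfl
      simp [this]
    · intro c G ω
      rw [← LinearMap.smul_apply]
      congr 1
      ext a b
      have : (c • G).curryLeft a = c • G.curryLeft a := rfl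
      simp [this]
    · intros; simp
    · intros; simp
    · intro G ω
      rw [sw_sum_head, LinearMap.mk₂_apply, ← sumDelta]
      apply list_sum_congr
      intro p
      rw [LinearMap.comp_apply, ← hΦ]
      simp

theorem sw_counit (D : HopfData H) (n : ℕ) (j : Fin (n + 2)) (ω : H)
    (G : MultilinearMap ℂ (fun _ : Fin (n + 1) => H) ℂ) :
    ((D.sw (n + 1) ω).map fun v => epsi (v j) * G fun i => v (j.succAbove i)).sum
      = ((D.sw n ω).map fun v => G v).sum := by
  induction n generalizing ω with
  | zero =>
    obtain ⟨Φ, hΦ⟩ := sw_sum_linear D 0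
    have h0 : ∀ ω, (Φ G ω) = G fun _ => ω := by
      intro ω; rw [← hΦ]; simp [HopfData.sw]
    rw [hΦ, sw_sum_head]
    fin_cases j
    · rw [← counit_left D (Φ G)]
      apply list_sum_congr
      intro p
      simp [HopfData.sw, h0]
    · rw [← counit_right D (Φ G)]
      apply list_sum_congr
      intro p
      rw [h0]
      simp only [HopfData.sw, List.map_cons, List.map_nil, List.sum_cons, List.sum_nil, add_zero,
        smul_eq_mul]
      congr 1
      congr 1
      funext i
      fin_cases i
      rfl
  | succ n ih =>
    obtain ⟨Φ, hΦ⟩ := sw_sum_linear D (n + 1)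
    rw [sw_sum_head]
    cases j using Fin.cases with
    | zero =>
      rw [hΦ, ← counit_left D (Φ G)]
      apply list_sum_congr
      intro p
      simp only [Fin.cons_zero, Fin.zero_succAbove, Fin.cons_succ]
      rw [list_sum_mul, hΦ, smul_eq_mul]
    | succ j =>
      rw [sw_sum_head]
      apply list_sum_congr
      intro p
      have := ih j p.2 (G.curryLeft p.1)
      simp only [MultilinearMap.curryLeft_apply] at this
      rw [← this]
      apply list_sum_congr
      intro v
      rw [Fin.cons_succ]
      congr 2
      funext i
      cases i using Fin.cases <;> simp

end HopfPart


section LinPart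
variable {B : Type} [Ring B] [Algebra ℂ B] {n : ℕ}

theorem tRaw_add (D : HopfData H) (act : H → B → B) (f g : Raw H B n) :
    tRaw D act (f + g) = tRaw D act f + tRaw D act g := by
  funext ω b
  simp only [tRaw, Pi.add_apply]
  exact list_sum_add _ _ _

theorem tRaw_smul (D : HopfData H) (act : H → B → B) (c : ℂ) (f : Raw H B n) :
    tRaw D act (c • f) = c • tRaw D act f := by
  funext ω b
  simp only [tRaw, Pi.smul_apply, smul_eq_mul]
  exact list_sum_mul _ _ _

theorem dRaw_add (D : HopfData H) (act : H → B → B) (i : Fin (n + 2)) (f g : Raw H B n) :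
    dRaw D act i (f + g) = dRaw D act i f + dRaw D act i g := by
  unfold dRaw
  split_ifs
  · rfl
  · rw [← tRaw_add]; rfl

theorem dRaw_smul (D : HopfData H) (act : H → B → B) (i : Fin (n + 2)) (c : ℂ) (f : Raw H B n) :
    dRaw D act i (c • f) = c • dRaw D act i f := by
  unfold dRaw
  split_ifs
  · rfl
  · rw [← tRaw_smul]; rfl

/-- the cyclic operator as a linear map -/
def tLin (D : HopfData H) (act : H → B → B) (n : ℕ) : Raw H B n →ₗ[ℂ] Raw H B n where
  toFun := tRaw D act
  map_add' := tRaw_add D act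
  map_smul' := tRaw_smul D act

/-- the cofaces as linear maps -/
def dLin (D : HopfData H) (act : H → B → B) (n : ℕ) (i : Fin (n + 2)) :
    Raw H B n →ₗ[ℂ] Raw H B (n + 1) where
  toFun := dRaw D act i
  map_add' := dRaw_add D act i
  map_smul' := dRaw_smul D act i

/-- the Hochschild coboundary as a linear map -/
def bLin (D : HopfData H) (act : H → B → B) (n : ℕ) : Raw H B n →ₗ[ℂ] Raw H B (n + 1) :=
  ∑ i : Fin (n + 2), ((-1 : ℂ) ^ (i : ℕ)) • dLin D act n i

theorem bLin_apply (D : HopfData H) (act : H → B → B) (f : Raw H B n) :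
    bLin D act n f = bRaw D act f := by
  funext ω b
  simp [bLin, bRaw, dLin, Finset.sum_apply]

/-- the cochains `C^n_H(B)` as a submodule -/
def cSub (D : HopfData H) (act : H → B → B) (n : ℕ) : Submodule ℂ (Raw H B n) where
  carrier := {f | InC D act f}
  zero_mem' := by
    refine ⟨⟨?_, ?_, ?_, ?_⟩, ?_⟩ <;> intro _ _ _ <;> simp
  add_mem' := by
    rintro f g ⟨⟨f1, f2, f3, f4⟩, f5⟩ ⟨⟨g1, g2, g3, g4⟩, g5⟩
    refine ⟨⟨?_, ?_, ?_, ?_⟩, ?_⟩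
    · intro ω η b; simp only [Pi.add_apply, f1, g1]; ring
    · intro ω η b; simp only [Pi.add_apply, f2, g2]; ring
    · intros; simp only [Pi.add_apply, f3, g3]; ring
    · intros; simp only [Pi.add_apply, f4, g4]; ring
    · intro ω η b
      simp only [Pi.add_apply, mul_add]
      rw [← f5 ω η b, ← g5 ω η b]
      exact list_sum_add _ _ _
  smul_mem' := by
    rintro c f ⟨⟨f1, f2, f3, f4⟩, f5⟩
    refine ⟨⟨?_, ?_, ?_, ?_⟩, ?_⟩
    · intro ω η b; simp only [Pi.smul_apply, smul_eq_mul, f1]; ring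
    · intro ω η b; simp only [Pi.smul_apply, smul_eq_mul, f2]; ring
    · intros; simp only [Pi.smul_apply, smul_eq_mul, f3]; ring
    · intros; simp only [Pi.smul_apply, smul_eq_mul, f4]; ring
    · intro ω η b
      simp only [Pi.smul_apply, smul_eq_mul, mul_left_comm]
      rw [← f5 ω η b]
      exact list_sum_mul _ _ _

theorem isCyc_iff (D : HopfData H) (act : H → B → B) (f : Raw H B n) :
    IsCyc D act f ↔ ((-1 : ℂ) ^ n) • tLin D act n f = f := by
  constructor
  · intro h; funext ω b; exact h ω b
  · intro h ω b; exact congrFun (congrFun h ω) b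

/-- the cyclic functionals as a submodule -/
def cycSub (D : HopfData H) (act : H → B → B) (n : ℕ) : Submodule ℂ (Raw H B n) where
  carrier := {f | IsCyc D act f}
  zero_mem' := by simp [isCyc_iff]
  add_mem' := by
    intro f g hf hg
    simp only [Set.mem_ofPred_eq, isCyc_iff, map_add, smul_add] at *
    rw [hf, hg]
  smul_mem' := by
    intro c f hf
    simp only [Set.mem_ofPred_eq, isCyc_iff, map_smul] at *
    rw [smul_comm, hf]

/-- the cyclic cocycles as a submodule -/
def zSub (D : HopfData H) (act : H → B → B) (n : ℕ) : Submodule ℂ (Raw H B n) :=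
  cSub D act n ⊓ cycSub D act n ⊓ LinearMap.ker (bLin D act n)

theorem mem_zSub (D : HopfData H) (act : H → B → B) (f : Raw H B n) :
    f ∈ zSub D act n ↔ IsCocycle D act f := by
  unfold zSub IsCocycle
  rw [Submodule.mem_inf, Submodule.mem_inf, and_assoc, LinearMap.mem_ker, bLin_apply]
  refine and_congr Iff.rfl (and_congr Iff.rfl ?_)
  constructor
  · intro h ω b; rw [h]; rfl
  · intro h; funext ω b; exact h ω b

end LinPart

section Pull
variable {B : Type} [Ring B] [Algebra ℂ B] {B' : Type} [Ring B'] [Algebra ℂ B'] {n : ℕ}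

/-- pullback of cochains along a map -/
def pull (φ : B →ₗ[ℂ] B') (f : Raw H B' n) : Raw H B n := fun ω b => f ω fun i => φ (b i)

theorem comp_update {ι X Y : Type*} [DecidableEq ι] (φ : X → Y) (b : ι → X) (i : ι) (x : X) :
    (fun k => φ (Function.update b i x k)) = Function.update (fun k => φ (b k)) i (φ x) := by
  funext k
  by_cases h : k = i
  · subst h; simp
  · simp [h]

theorem pull_ml (φ : B →ₗ[ℂ] B') {f : Raw H B' n} (hf : IsML f) : IsML (pull φ f) := by
  obtain ⟨f1, f2, f3, f4⟩ := hf
  refine ⟨fun _ _ _ => f1 _ _ _, fun _ _ _ => f2 _ _ _, ?_, ?_⟩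
  · intro ω b i x y
    simp only [pull, comp_update, map_add, f3]
  · intro ω b i c x
    simp only [pull, comp_update, map_smul, f4]

variable (D : HopfData H) (act : H → B → B) (act' : H → B' → B') (φ : B →ₗ[ℂ] B')

theorem pull_t (hφ : ∀ ω b, act' ω (φ b) = φ (act ω b)) (f : Raw H B' n) :
    tRaw D act (pull φ f) = pull φ (tRaw D act' f) := by
  funext ω b
  simp only [tRaw, pull]
  apply list_sum_congr
  intro p
  congr 1
  funext i
  cases i using Fin.cases <;> simp [hφ]

theorem pull_inv (hφ : ∀ ω b, act' ω (φ b) = φ (act ω b)) {f : Raw H B' n}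
    (hf : IsInv D act' f) : IsInv D act (pull φ f) := by
  intro ω η b
  have := hf ω η (fun i => φ (b i))
  simp only [hφ] at this
  exact this

theorem pull_contract (hm : ∀ a b, φ (a * b) = φ a * φ b) (i : Fin (n + 1)) (b : Fin (n + 2) → B) :
    (fun k => φ (contract i b k)) = contract i fun k => φ (b k) := by
  funext k
  simp only [contract]
  split_ifs <;> simp [hm]

theorem pull_d (hφ : ∀ ω b, act' ω (φ b) = φ (act ω b)) (hm : ∀ a b, φ (a * b) = φ a * φ b)
    (i : Fin (n + 2)) (f : Raw H B' n) :
    dRaw D act i (pull φ f) = pull φ (dRaw D act' i f) := by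
  unfold dRaw
  split_ifs
  · funext ω b
    simp only [pull, pull_contract φ hm]
  · rw [← pull_t D act act' φ hφ]
    congr 1
    funext ω b
    simp only [pull, pull_contract φ hm]

theorem pull_b (hφ : ∀ ω b, act' ω (φ b) = φ (act ω b)) (hm : ∀ a b, φ (a * b) = φ a * φ b)
    (f : Raw H B' n) : bRaw D act (pull φ f) = pull φ (bRaw D act' f) := by
  funext ω b
  simp only [bRaw, pull_d D act act' φ hφ hm]
  rfl

theorem pull_cyc (hφ : ∀ ω b, act' ω (φ b) = φ (act ω b)) {f : Raw H B' n}
    (hf : IsCyc D act' f) : IsCyc D act (pull φ f) := by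
  intro ω b
  rw [pull_t D act act' φ hφ]
  exact hf ω _

theorem pull_inC (hφ : ∀ ω b, act' ω (φ b) = φ (act ω b)) {f : Raw H B' n}
    (hf : InC D act' f) : InC D act (pull φ f) :=
  ⟨pull_ml φ hf.1, pull_inv D act act' φ hφ hf.2⟩

theorem pull_cocycle (hφ : ∀ ω b, act' ω (φ b) = φ (act ω b))
    (hm : ∀ a b, φ (a * b) = φ a * φ b) {f : Raw H B' n}
    (hf : IsCocycle D act' f) : IsCocycle D act (pull φ f) := by
  refine ⟨pull_inC D act act' φ hφ hf.1, pull_cyc D act act' φ hφ hf.2.1, ?_⟩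
  intro ω b
  rw [pull_b D act act' φ hφ hm]
  exact hf.2.2 ω _

end Pull

section Inva
variable {B : Type} [Ring B] [Algebra ℂ B] {D : HopfData H} (A : MAlg D B)

theorem act_inv_mul {x : B} (hx : ∀ ω : H, A.fn ω x = epsi ω • x) (ω : H) (b : B) :
    A.fn ω (x * b) = x * A.fn ω b := by
  have h1 : A.fn ω (x * b) = ((D.Δl ω).map fun p => A.fn p.1 x * A.fn p.2 b).sum :=
    A.act_mul_mul ω x b
  have h2 := counit_left D ((LinearMap.mulLeft ℂ x) ∘ₗ (A.act.flip b)) ω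
  rw [h1]
  refine Eq.trans ?_ h2
  apply list_sum_congr
  intro p
  rw [hx, smul_mul_assoc]
  rfl

theorem act_mul_inv {x : B} (hx : ∀ ω : H, A.fn ω x = epsi ω • x) (ω : H) (b : B) :
    A.fn ω (b * x) = A.fn ω b * x := by
  have h1 : A.fn ω (b * x) = ((D.Δl ω).map fun p => A.fn p.1 b * A.fn p.2 x).sum :=
    A.act_mul_mul ω b x
  have h2 := counit_right D ((LinearMap.mulRight ℂ x) ∘ₗ (A.act.flip b)) ω
  rw [h1]
  refine Eq.trans ?_ h2
  apply list_sum_congr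
  intro p
  rw [hx, mul_smul_comm]
  rfl

theorem inva_inverse {u u' : B} (huu' : u * u' = 1) (hu'u : u' * u = 1)
    (hu : ∀ ω : H, A.fn ω u = epsi ω • u) (ω : H) : A.fn ω u' = epsi ω • u' := by
  have h := act_inv_mul A hu ω u'
  rw [huu', show A.fn ω 1 = epsi ω • (1 : B) from A.act_algOne ω] at h
  calc A.fn ω u' = u' * (u * A.fn ω u') := by rw [← mul_assoc, hu'u, one_mul]
    _ = _ := by rw [← h]; simp

theorem inva_one (ω : H) : A.fn ω 1 = epsi ω • (1 : B) := A.act_algOne ω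

theorem fn_add (ω : H) (a b : B) : A.fn ω (a + b) = A.fn ω a + A.fn ω b := (A.act ω).map_add a b
theorem fn_smul (ω : H) (c : ℂ) (b : B) : A.fn ω (c • b) = c • A.fn ω b := (A.act ω).map_smul c b
theorem fn_sub (ω : H) (a b : B) : A.fn ω (a - b) = A.fn ω a - A.fn ω b := (A.act ω).map_sub a b
theorem fn_zero (ω : H) : A.fn ω (0 : B) = 0 := (A.act ω).map_zero
theorem fn_add_left (ω η : H) (b : B) : A.fn (ω + η) b = A.fn ω b + A.fn η b := by
  change A.act (ω + η) b = _
  simp; rfl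
theorem fn_smul_left (c : ℂ) (ω : H) (b : B) : A.fn (c • ω) b = c • A.fn ω b := by
  change A.act (c • ω) b = _
  simp; rfl

/-- conjugation as a linear map -/
def conjLin (u u' : B) : B →ₗ[ℂ] B := LinearMap.mulRight ℂ u' ∘ₗ LinearMap.mulLeft ℂ u

theorem adPull_eq (u u' : B) {n : ℕ} (f : Raw H B n) : adPull u u' f = pull (conjLin u u') f := rfl

theorem conj_equiv {u u' : B}
    (hu : ∀ ω : H, A.fn ω u = epsi ω • u) (hu' : ∀ ω : H, A.fn ω u' = epsi ω • u') (ω : H) (b : B) :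
    A.fn ω (conjLin u u' b) = conjLin u u' (A.fn ω b) := by
  simp [conjLin, act_mul_inv A hu', act_inv_mul A hu]

theorem conjLin_mul {u u' : B} (hu'u : u' * u = 1) (a b : B) :
    conjLin u u' (a * b) = conjLin u u' a * conjLin u u' b := by
  simp only [conjLin, LinearMap.comp_apply, LinearMap.mulLeft_apply, LinearMap.mulRight_apply]
  calc u * (a * b) * u' = u * a * 1 * b * u' := by simp [mul_assoc]
    _ = _ := by rw [← hu'u]; simp only [mul_assoc]

theorem adPull_cocycle {u u' : B} (huu' : u * u' = 1) (hu'u : u' * u = 1)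
    (hu : ∀ ω : H, A.fn ω u = epsi ω • u) {n : ℕ} {f : Raw H B n}
    (hf : IsCocycle D A.fn f) : IsCocycle D A.fn (adPull u u' f) :=
  pull_cocycle D A.fn A.fn (conjLin u u')
    (conj_equiv A hu (inva_inverse A huu' hu'u hu)) (conjLin_mul hu'u) hf

end Inva


section Comb
variable {B : Type}

theorem exists_nat_fun [Zero B] {n : ℕ} (b : Fin n → B) :
    ∃ β : ℕ → B, b = fun i : Fin n => β (i : ℕ) := by
  refine ⟨fun k => if h : k < n then b ⟨k, h⟩ else 0, ?_⟩
  funext i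
  simp

theorem insertNth_nat {n : ℕ} (j : Fin (n + 1)) (x : B) (β : ℕ → B) :
    (Fin.insertNth j x (fun i : Fin n => β i) : Fin (n + 1) → B) =
      fun k : Fin (n + 1) => if (k : ℕ) < j then β k else if (k : ℕ) = j then x else β (k - 1) := by
  refine (Fin.eq_insertNth_iff (α := fun _ => B)).2 ⟨by simp, ?_⟩ |>.symm
  funext i
  simp only [Fin.removeNth]
  by_cases h : i.castSucc < j
  · rw [Fin.succAbove_of_castSucc_lt _ _ h]
    have : (i : ℕ) < j := h
    simp [this]
  · rw [Fin.succAbove_of_le_castSucc _ _ (not_lt.1 h)]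
    have : ¬ (i : ℕ) < j := h
    simp only [Fin.val_succ]
    rw [if_neg (by omega), if_neg (by omega)]
    simp

theorem cons_nat {n : ℕ} (x : B) (β : ℕ → B) :
    (Fin.cons x (fun i : Fin n => β i) : Fin (n + 1) → B) =
      fun k : Fin (n + 1) => if (k : ℕ) = 0 then x else β (k - 1) := by
  funext k
  cases k using Fin.cases <;> simp

theorem update_nat {n : ℕ} (j : Fin n) (x : B) (β : ℕ → B) :
    Function.update (fun i : Fin n => β i) j x =
      fun k : Fin n => if (k : ℕ) = j then x else β k := by
  funext k
  by_cases h : k = j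
  · subst h; simp
  · have : (k : ℕ) ≠ j := fun h' => h (Fin.ext h')
    simp [h, this]

theorem contract_nat [Ring B] {n : ℕ} (i : Fin (n + 1)) (β : ℕ → B) :
    contract i (fun i : Fin (n + 2) => β i) =
      fun k : Fin (n + 1) => if (k : ℕ) < i then β k else if (k : ℕ) = i then β k * β (k + 1) else β (k + 1) := by
  funext k
  simp [contract]

theorem contract_ins_lt [Ring B] {n : ℕ} (i : Fin (n + 1)) (j : Fin (n + 2)) (h : (i : ℕ) < j) (x : B)
    (b : Fin (n + 2) → B) :
    (Fin.insertNth j x (contract i b) : Fin (n + 2) → B)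
      = contract i.castSucc (Fin.insertNth j.succ x b : Fin (n + 3) → B) := by
  obtain ⟨β, rfl⟩ := exists_nat_fun b
  rw [contract_nat, insertNth_nat (β := fun k => if k < i then β k else if k = i then
    β k * β (k + 1) else β (k + 1)), insertNth_nat, contract_nat (β := fun k => if k < j.succ then β k
      else if k = j.succ then x else β (k - 1))]
  funext k
  obtain ⟨k, hk⟩ := k
  obtain ⟨j, hj⟩ := j
  obtain ⟨i, hi⟩ := i
  simp only [Fin.val_succ, Fin.val_castSucc] at *
  grind

theorem contract_ins_ge [Ring B] {n : ℕ} (i : Fin (n + 1)) (j : Fin (n + 2)) (h : (j : ℕ) ≤ i) (x : B)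
    (b : Fin (n + 2) → B) :
    (Fin.insertNth j x (contract i b) : Fin (n + 2) → B)
      = contract i.succ (Fin.insertNth j.castSucc x b : Fin (n + 3) → B) := by
  obtain ⟨β, rfl⟩ := exists_nat_fun b
  rw [contract_nat, insertNth_nat (β := fun k => if k < i then β k else if k = i then
    β k * β (k + 1) else β (k + 1)), insertNth_nat, contract_nat (β := fun k => if k < j.castSucc
      then β k else if k = j.castSucc then x else β (k - 1))]
  funext k
  obtain ⟨k, hk⟩ := k
  obtain ⟨j, hj⟩ := j
  obtain ⟨i, hi⟩ := i
  simp only [Fin.val_succ, Fin.val_castSucc] at *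
  grind

theorem contract_ins_self [Ring B] {n : ℕ} (j : Fin (n + 1)) (x : B) (b : Fin (n + 1) → B) :
    contract j (Fin.insertNth j.castSucc x b : Fin (n + 2) → B)
      = Function.update b j (x * b j) := by
  obtain ⟨β, rfl⟩ := exists_nat_fun b
  rw [update_nat, insertNth_nat, contract_nat (β := fun k => if k < j.castSucc
      then β k else if k = j.castSucc then x else β (k - 1))]
  funext k
  obtain ⟨k, hk⟩ := k
  obtain ⟨j, hj⟩ := j
  simp only [Fin.val_castSucc] at *
  grind

theorem contract_ins_succ [Ring B] {n : ℕ} (j : Fin (n + 1)) (x : B) (b : Fin (n + 1) → B) :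
    contract j (Fin.insertNth j.succ x b : Fin (n + 2) → B)
      = Function.update b j (b j * x) := by
  obtain ⟨β, rfl⟩ := exists_nat_fun b
  rw [update_nat, insertNth_nat, contract_nat (β := fun k => if k < j.succ
      then β k else if k = j.succ then x else β (k - 1))]
  funext k
  obtain ⟨k, hk⟩ := k
  obtain ⟨j, hj⟩ := j
  simp only [Fin.val_succ] at *
  grind

/-- the combinatorial heart of the Cartan homotopy formula -/
theorem cartan_sum (N : ℕ) (Z : ℕ → ℕ → ℂ)
    (hZ : ∀ j < N + 1, ∑ i ∈ Finset.range (N + 2), Z j i = 0) :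
    ∑ j ∈ Finset.range N, ∑ i ∈ Finset.range (N + 1),
        (if i ≤ j then Z (j + 1) i else Z j (i + 1))
      = - ∑ j ∈ Finset.range (N + 1), (Z j j + Z j (j + 1)) := by
  have h1 : ∑ j ∈ Finset.range N, ∑ i ∈ Finset.range (N + 1), (if i ≤ j then Z (j + 1) i else 0)
      = ∑ j ∈ Finset.range (N + 1), ∑ i ∈ Finset.range (N + 2), (if i < j then Z j i else 0) := by
    rw [Finset.sum_range_succ' _ N]
    simp only [Nat.not_lt_zero, if_false, Finset.sum_const_zero, add_zero]
    refine Finset.sum_congr rfl fun j hj => ?_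
    rw [Finset.sum_range_succ _ (N + 1)]
    simp only [Finset.mem_range] at hj
    rw [if_neg (by omega), add_zero]
    refine Finset.sum_congr rfl fun i hi => ?_
    simp only [Nat.lt_succ_iff]
  have h2 : ∑ j ∈ Finset.range N, ∑ i ∈ Finset.range (N + 1), (if i ≤ j then 0 else Z j (i + 1))
      = ∑ j ∈ Finset.range (N + 1), ∑ i ∈ Finset.range (N + 2),
          (if j + 1 < i then Z j i else 0) := by
    rw [Finset.sum_range_succ _ N]
    rw [Finset.sum_eq_zero (s := Finset.range (N + 2)), add_zero]
    · refine Finset.sum_congr rfl fun j hj => ?_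
      rw [Finset.sum_range_succ' _ (N + 1)]
      rw [if_neg (by omega), add_zero]
      refine Finset.sum_congr rfl fun i hi => ?_
      by_cases h : i ≤ j
      · rw [if_pos h, if_neg (by omega)]
      · rw [if_neg h, if_pos (by omega)]
    · intro i hi
      simp only [Finset.mem_range] at hi
      rw [if_neg (by omega)]
  have h3 : ∀ j < N + 1, ∑ i ∈ Finset.range (N + 2), (if i < j then Z j i else 0) +
      ∑ i ∈ Finset.range (N + 2), (if j + 1 < i then Z j i else 0) = - (Z j j + Z j (j + 1)) := by
    intro j hj
    have e1 : Z j j = ∑ i ∈ Finset.range (N + 2), if i = j then Z j i else 0 := by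
      rw [Finset.sum_ite_eq' , if_pos (by simp; omega)]
    have e2 : Z j (j + 1) = ∑ i ∈ Finset.range (N + 2), if i = j + 1 then Z j i else 0 := by
      rw [Finset.sum_ite_eq' , if_pos (by simp; omega)]
    rw [eq_neg_iff_add_eq_zero, e1, e2, ← Finset.sum_add_distrib, ← Finset.sum_add_distrib,
      ← Finset.sum_add_distrib]
    refine Eq.trans ?_ (hZ j hj)
    refine Finset.sum_congr rfl fun i _ => ?_
    split_ifs <;> first | omega | simp
  rw [← Finset.sum_neg_distrib, ← Finset.sum_congr rfl fun j hj => h3 j (Finset.mem_range.1 hj),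
    Finset.sum_add_distrib, ← h1, ← h2, ← Finset.sum_add_distrib]
  refine Finset.sum_congr rfl fun j _ => ?_
  rw [← Finset.sum_add_distrib]
  refine Finset.sum_congr rfl fun i _ => ?_
  split_ifs <;> simp

end Comb


section Cartan
variable {B : Type} [Ring B] [Algebra ℂ B] {n : ℕ}

/-- insertion of a fixed element in position `j` -/
def insX (x : B) (j : Fin (n + 2)) (f : Raw H B (n + 1)) : Raw H B n :=
  fun ω b => f ω (Fin.insertNth j x b)

/-- the contraction operator -/
def psiX (x : B) (f : Raw H B (n + 1)) : Raw H B n :=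
  ∑ j : Fin (n + 1), ((-1 : ℂ) ^ ((j : ℕ) + 1)) • insX x j.succ f

/-- the Lie derivative along the inner derivation -/
def lieX (x : B) (f : Raw H B n) : Raw H B n :=
  fun ω b => ∑ j : Fin (n + 1), f ω (Function.update b j (x * b j - b j * x))

theorem t_insX (D : HopfData H) (act : H → B → B) (x : B) (j : Fin (n + 1)) (f : Raw H B (n + 1)) :
    tRaw D act (insX x j.succ f) = insX x j.castSucc (tRaw D act f) := by
  funext ω b
  simp only [tRaw, insX]
  apply list_sum_congr
  intro p
  congr 1
  obtain ⟨β, rfl⟩ := exists_nat_fun b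
  rw [insertNth_nat]
  simp only [Fin.val_last, Fin.val_castSucc]
  rw [cons_nat, insertNth_nat (β := fun k => if k = 0 then act p.2 (β n) else β (k - 1)),
    cons_nat (β := fun k => if k < j then β k else if k = j then x else β (k - 1))]
  funext k
  obtain ⟨k, hk⟩ := k
  obtain ⟨j, hj⟩ := j
  simp only [Fin.val_succ, Nat.add_sub_cancel] at *
  grind

theorem insX_last_t (D : HopfData H) (act : H → B → B) (x : B)
    (hx : ∀ ω, act ω x = epsi ω • x) (f : Raw H B (n + 1))
    (h1 : ∀ ω η b, f (ω + η) b = f ω b + f η b)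
    (h2 : ∀ (c : ℂ) ω b, f (c • ω) b = c * f ω b)
    (h3 : ∀ (c : ℂ) ω (b : Fin (n + 1) → B), f ω (Fin.cons (c • x) b) = c * f ω (Fin.cons x b)) :
    insX x (Fin.last (n + 1)) (tRaw D act f) = insX x 0 f := by
  funext ω b
  simp only [tRaw, insX, Fin.insertNth_zero, Fin.insertNth_last']
  simp only [Fin.snoc_last, Fin.snoc_castSucc, hx, h3]
  exact counit_right D (IsLinearMap.mk' (fun ω => f ω (Fin.cons x b : Fin (n + 2) → B))
    ⟨fun _ _ => h1 _ _ _, fun _ _ => h2 _ _ _⟩) ω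

theorem ml_cons_smul {f : Raw H B n} (hf : IsML f) (c : ℂ) (ω : H) (x : B) (b : Fin n → B) :
    f ω (Fin.cons (c • x) b) = c * f ω (Fin.cons x b) := by
  have := hf.2.2.2 ω (Fin.cons x b) 0 c x
  simpa only [Fin.update_cons_zero] using this

theorem insX_ml {f : Raw H B (n + 1)} (hf : IsML f) (x : B) (j : Fin (n + 2)) :
    IsML (insX x j f) := by
  obtain ⟨f1, f2, f3, f4⟩ := hf
  refine ⟨fun _ _ _ => f1 _ _ _, fun _ _ _ => f2 _ _ _, ?_, ?_⟩
  · intro ω b i y z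
    simp only [insX, Fin.insertNth_update]
    exact f3 _ _ _ _ _
  · intro ω b i c y
    simp only [insX, Fin.insertNth_update]
    exact f4 _ _ _ _ _

theorem fin_ne_a (k : Fin (n + 1)) : k.succ.succ ≠ (1 : Fin (n + 3)) := by
  rw [← Fin.succ_zero_eq_one]
  intro h
  exact Fin.succ_ne_zero k (Fin.succ_injective _ h)

theorem fin_ne_b : (0 : Fin (n + 3)) ≠ 1 := by
  rw [← Fin.succ_zero_eq_one]
  exact (Fin.succ_ne_zero _).symm

/-- the multilinear expression of which invariance takes the Sweedler sum -/
def invML {D : HopfData H} (A : MAlg D B) {f : Raw H B n} (hf : IsML f) (η : H)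
    (b : Fin (n + 1) → B) : MultilinearMap ℂ (fun _ : Fin (n + 3) => H) ℂ where
  toFun v := f (D.Sinv (v 0) * η * v 1) fun i => A.fn (v i.succ.succ) (b i)
  map_update_add' := by
    intro inst v i x y
    obtain ⟨f1, f2, f3, f4⟩ := hf
    cases i using Fin.cases with
    | zero =>
      have u1 : ∀ z, Function.update v 0 z 1 = v 1 := fun z =>
        Function.update_of_ne fin_ne_b.symm _ _
      have u2 : ∀ z (k : Fin (n + 1)), Function.update v 0 z k.succ.succ = v k.succ.succ :=
        fun z k => Function.update_of_ne (Fin.succ_ne_zero _) _ _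
      simp only [Function.update_self, u1, u2, map_add, add_mul, f1]
    | succ i =>
      cases i using Fin.cases with
      | zero =>
        rw [Fin.succ_zero_eq_one]
        have u1 : ∀ z, Function.update v 1 z 0 = v 0 := fun z =>
          Function.update_of_ne fin_ne_b _ _
        have u2 : ∀ z (k : Fin (n + 1)), Function.update v 1 z k.succ.succ = v k.succ.succ :=
          fun z k => Function.update_of_ne (fin_ne_a k) _ _
        simp only [Function.update_self, u1, u2, mul_add, f1]
      | succ i =>
        have u1 : ∀ z, Function.update v i.succ.succ z 0 = v 0 := fun z =>
          Function.update_of_ne (Fin.succ_ne_zero _).symm _ _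
        have u2 : ∀ z, Function.update v i.succ.succ z 1 = v 1 := fun z =>
          Function.update_of_ne (fin_ne_a i).symm _ _
        have h3 : ∀ z, (fun k => A.fn (Function.update v i.succ.succ z k.succ.succ) (b k))
            = Function.update (fun k => A.fn (v k.succ.succ) (b k)) i (A.fn z (b i)) := by
          intro z
          funext k
          by_cases h : k = i
          · subst h; rw [Function.update_self, Function.update_self]
          · rw [Function.update_of_ne h, Function.update_of_ne]
            intro h'
            exact h (Fin.succ_injective _ (Fin.succ_injective _ h'))
        simp only [u1, u2, h3, fn_add_left, f3]
  map_update_smul' := by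
    intro inst v i c x
    obtain ⟨f1, f2, f3, f4⟩ := hf
    cases i using Fin.cases with
    | zero =>
      have u1 : ∀ z, Function.update v 0 z 1 = v 1 := fun z =>
        Function.update_of_ne fin_ne_b.symm _ _
      have u2 : ∀ z (k : Fin (n + 1)), Function.update v 0 z k.succ.succ = v k.succ.succ :=
        fun z k => Function.update_of_ne (Fin.succ_ne_zero _) _ _
      simp only [Function.update_self, u1, u2, map_smul, smul_mul_assoc, f2, smul_eq_mul]
    | succ i =>
      cases i using Fin.cases with
      | zero =>
        rw [Fin.succ_zero_eq_one]
        have u1 : ∀ z, Function.update v 1 z 0 = v 0 := fun z =>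
          Function.update_of_ne fin_ne_b _ _
        have u2 : ∀ z (k : Fin (n + 1)), Function.update v 1 z k.succ.succ = v k.succ.succ :=
          fun z k => Function.update_of_ne (fin_ne_a k) _ _
        simp only [Function.update_self, u1, u2, mul_smul_comm, f2, smul_eq_mul]
      | succ i =>
        have u1 : ∀ z, Function.update v i.succ.succ z 0 = v 0 := fun z =>
          Function.update_of_ne (Fin.succ_ne_zero _).symm _ _
        have u2 : ∀ z, Function.update v i.succ.succ z 1 = v 1 := fun z =>
          Function.update_of_ne (fin_ne_a i).symm _ _
        have h3 : ∀ z, (fun k => A.fn (Function.update v i.succ.succ z k.succ.succ) (b k))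
            = Function.update (fun k => A.fn (v k.succ.succ) (b k)) i (A.fn z (b i)) := by
          intro z
          funext k
          by_cases h : k = i
          · subst h; rw [Function.update_self, Function.update_self]
          · rw [Function.update_of_ne h, Function.update_of_ne]
            intro h'
            exact h (Fin.succ_injective _ (Fin.succ_injective _ h'))
        simp only [u1, u2, h3, fn_smul_left, f4, smul_eq_mul]

theorem insX_inC {D : HopfData H} (A : MAlg D B) {x : B} (hx : ∀ ω : H, A.fn ω x = epsi ω • x)
    {f : Raw H B (n + 1)} (hf : InC D A.fn f) (j : Fin (n + 2)) : InC D A.fn (insX x j f) := by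
  refine ⟨insX_ml hf.1 x j, ?_⟩
  intro ω η b
  have h := hf.2 ω η (Fin.insertNth j x b)
  refine Eq.trans ?_ h
  refine (sw_counit D (n + 2) j.succ.succ ω (invML A (insX_ml hf.1 x j) η b)).symm.trans ?_
  apply list_sum_congr
  intro v
  simp only [invML, MultilinearMap.coe_mk, insX]
  have e0 : j.succ.succ.succAbove 0 = 0 := by simp
  have e1 : j.succ.succ.succAbove 1 = 1 := by
    rw [← Fin.succ_zero_eq_one, Fin.succ_succAbove_succ]; simp
  rw [e0, e1]
  have e2 : (fun i => A.fn (v i.succ.succ) ((Fin.insertNth j x b : Fin (n + 2) → B) i))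
      = Fin.insertNth j (epsi (v j.succ.succ) • x)
        (fun i => A.fn (v (j.succ.succ.succAbove i.succ.succ)) (b i)) := by
    refine (Fin.eq_insertNth_iff (α := fun _ => B)).2 ⟨by simp [hx], ?_⟩
    funext i
    simp [Fin.removeNth]
  rw [e2]
  have := hf.1.2.2.2 (D.Sinv (v 0) * η * v 1) (Fin.insertNth j x
    (fun i => A.fn (v (j.succ.succ.succAbove i.succ.succ)) (b i))) j (epsi (v j.succ.succ)) x
  simp only [Fin.update_insertNth] at this
  rw [this]

theorem psiX_inC {D : HopfData H} (A : MAlg D B) {x : B} (hx : ∀ ω : H, A.fn ω x = epsi ω • x)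
    {f : Raw H B (n + 1)} (hf : InC D A.fn f) : InC D A.fn (psiX x f) := by
  change psiX x f ∈ cSub D A.fn n
  exact Submodule.sum_mem _ fun j _ => Submodule.smul_mem _ _ (insX_inC A hx hf _)

theorem insX_smul (x : B) (j : Fin (n + 2)) (c : ℂ) (f : Raw H B (n + 1)) :
    insX x j (c • f) = c • insX x j f := rfl

theorem psiX_cyc {D : HopfData H} (A : MAlg D B) {x : B} (hx : ∀ ω : H, A.fn ω x = epsi ω • x)
    {f : Raw H B (n + 1)} (hf : IsML f) (hc : IsCyc D A.fn f) : IsCyc D A.fn (psiX x f) := by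
  rw [isCyc_iff] at *
  have ht : tRaw D A.fn f = ((-1 : ℂ) ^ (n + 1)) • f := by
    nth_rewrite 2 [← hc]
    rw [smul_smul, ← mul_pow]
    simp [tLin]
  have hl : insX x (Fin.last (n + 1)) f = ((-1 : ℂ) ^ (n + 1)) • insX x 0 f := by
    rw [← insX_last_t D A.fn x hx f hf.1 hf.2.1 fun c ω b => ml_cons_smul hf c ω x b, ht,
      insX_smul, smul_smul, ← mul_pow]
    simp
  have hS : ∑ j : Fin (n + 2), ((-1 : ℂ) ^ (j : ℕ)) • insX x j f = insX x 0 f + psiX x f := by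
    rw [Fin.sum_univ_succ]
    simp [psiX]
  have hS' : ∑ j : Fin (n + 2), ((-1 : ℂ) ^ (j : ℕ)) • insX x j f =
      ((-1 : ℂ) ^ n) • tLin D A.fn n (psiX x f) + insX x 0 f := by
    rw [Fin.sum_univ_castSucc, hl, smul_smul]
    simp only [Fin.val_last, ← mul_pow]
    simp only [mul_neg, mul_one, neg_neg, one_pow, one_smul]
    congr 1
    rw [psiX, map_sum, Finset.smul_sum]
    refine Finset.sum_congr rfl fun j _ => ?_
    rw [map_smul, smul_smul]
    change _ = _ • tRaw D A.fn (insX x j.succ f)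
    rw [t_insX, ht, insX_smul, smul_smul]
    congr 1
    have : (-1 : ℂ) ^ n * (-1) ^ n = 1 := by rw [← mul_pow]; simp
    simp only [Fin.val_castSucc, pow_succ]
    linear_combination (- (-1 : ℂ) ^ (j : ℕ)) * this
  rw [hS, add_comm] at hS'
  exact (add_right_cancel hS').symm

theorem dRaw_castSucc (D : HopfData H) (act : H → B → B) (i : Fin (n + 1)) (f : Raw H B n) :
    dRaw D act i.castSucc f = fun ω b => f ω (contract i b) := by
  unfold dRaw
  rw [dif_pos (show ((i.castSucc : Fin (n + 2)) : ℕ) < n + 1 from i.isLt)]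
  rfl

theorem dRaw_last (D : HopfData H) (act : H → B → B) (f : Raw H B n) :
    dRaw D act (Fin.last (n + 1)) f = tRaw D act fun ω b => f ω (contract 0 b) := by
  simp [dRaw]

theorem d_insX_lt (D : HopfData H) (act : H → B → B) (x : B) (i : Fin (n + 2)) (j : Fin (n + 2))
    (h : (i : ℕ) < j) (f : Raw H B (n + 1)) :
    dRaw D act i (insX x j f) = insX x j.succ (dRaw D act i.castSucc f) := by
  cases i using Fin.lastCases with
  | last => simp at h; omega
  | cast i =>
    rw [dRaw_castSucc, dRaw_castSucc]
    funext ω b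
    simp only [insX]
    rw [contract_ins_lt i j h]

theorem d_insX_ge (D : HopfData H) (act : H → B → B) (x : B) (i : Fin (n + 2)) (j : Fin (n + 1))
    (h : (j : ℕ) + 1 ≤ i) (f : Raw H B (n + 1)) :
    dRaw D act i (insX x j.succ f) = insX x j.succ.castSucc (dRaw D act i.succ f) := by
  cases i using Fin.lastCases with
  | last =>
    rw [dRaw_last, Fin.succ_last, dRaw_last, ← t_insX]
    congr 1
    funext ω b
    simp only [insX]
    rw [contract_ins_lt 0 j.succ (by simp)]
    rfl
  | cast i =>
    rw [dRaw_castSucc, ← Fin.castSucc_succ, dRaw_castSucc]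
    funext ω b
    simp only [insX]
    rw [contract_ins_ge i j.succ (by simpa using h)]

theorem cartan {D : HopfData H} (A : MAlg D B) {x : B} (hx : ∀ ω : H, A.fn ω x = epsi ω • x)
    {f : Raw H B (n + 1)} (hf : IsML f) (hb : ∀ ω b, bRaw D A.fn f ω b = 0) :
    bRaw D A.fn (psiX x f) = lieX x f := by
  funext ω b
  let X : ℕ → ℕ → ℂ := fun j i => if h : j < n + 3 ∧ i < n + 3 then
    insX x (⟨j, h.1⟩ : Fin (n + 3)) (dRaw D A.fn (⟨i, h.2⟩ : Fin (n + 3)) f) ω b else 0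
  have hX : ∀ j i : Fin (n + 3), X j i = insX x j (dRaw D A.fn i f) ω b := by
    intro j i
    simp [X]
  let Z : ℕ → ℕ → ℂ := fun j i => (-1) ^ (i + j + 1) * X (j + 1) i
  have hZ : ∀ j < n + 1 + 1, ∑ i ∈ Finset.range (n + 1 + 2), Z j i = 0 := by
    intro j hj
    have h := hb ω (Fin.insertNth (⟨j + 1, by omega⟩ : Fin (n + 3)) x b)
    unfold bRaw at h
    rw [Finset.sum_range]
    have h' := congrArg (fun z => (-1 : ℂ) ^ (j + 1) * z) h
    simp only [Finset.mul_sum, mul_zero] at h'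
    rw [← h']
    refine Finset.sum_congr rfl fun i _ => ?_
    have := hX ⟨j + 1, by omega⟩ i
    simp only [Z]
    simp only [insX] at this
    rw [this]
    ring
  have key := cartan_sum (n + 1) Z hZ
  have hL : bRaw D A.fn (psiX x f) ω b = - ∑ j ∈ Finset.range (n + 1), ∑ i ∈ Finset.range (n + 1 + 1),
        (if i ≤ j then Z (j + 1) i else Z j (i + 1)) := by
    rw [Finset.sum_comm, Finset.sum_range, bRaw, ← Finset.sum_neg_distrib]
    refine Finset.sum_congr rfl fun i _ => ?_
    rw [Finset.sum_range, ← Finset.sum_neg_distrib]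
    have e : dRaw D A.fn i (psiX x f)
        = ∑ j : Fin (n + 1), ((-1 : ℂ) ^ ((j : ℕ) + 1)) • dRaw D A.fn i (insX x j.succ f) := by
      change dLin D A.fn n i (psiX x f) = _
      rw [psiX, map_sum]
      refine Finset.sum_congr rfl fun j _ => ?_
      rw [map_smul]
      rfl
    rw [e]
    simp only [Finset.sum_apply, Pi.smul_apply, smul_eq_mul, Finset.mul_sum]
    refine Finset.sum_congr rfl fun j _ => ?_
    split_ifs with h
    · rw [d_insX_lt D A.fn x i j.succ (by simp; omega), ← hX]
      simp only [Z, Fin.val_succ, Fin.val_castSucc]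
      ring
    · rw [d_insX_ge D A.fn x i j (by omega), ← hX]
      simp only [Z, Fin.val_succ, Fin.val_castSucc]
      ring
  rw [hL, key, neg_neg]
  have e1 : ∀ j, Z j j + Z j (j + 1) = X (j + 1) (j + 1) - X (j + 1) j := by
    intro j
    have h2 : (-1 : ℂ) ^ (j + j) = 1 := by rw [pow_add, ← mul_pow]; simp
    have : (-1 : ℂ) ^ (j + j + 1) = -1 := by rw [pow_succ, h2]; simp
    have h3 : (-1 : ℂ) ^ (j + 1 + j + 1) = 1 := by
      rw [show j + 1 + j + 1 = j + j + 1 + 1 by ring, pow_succ, this]; simp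
    simp only [Z, this, h3]
    ring
  have hz : contract (0 : Fin (n + 2)) (Fin.cons x b : Fin (n + 3) → B)
      = Function.update b 0 (x * b 0) := by
    have := contract_ins_self (0 : Fin (n + 2)) x b
    rwa [Fin.castSucc_zero, Fin.insertNth_zero] at this
  have hz' : ∀ (c : ℂ) (b : Fin (n + 2) → B),
      contract (0 : Fin (n + 2)) (Fin.cons (c • x) b : Fin (n + 3) → B)
      = Function.update b 0 (c • (x * b 0)) := by
    intro c b
    have := contract_ins_self (0 : Fin (n + 2)) (c • x) b
    rwa [Fin.castSucc_zero, Fin.insertNth_zero, smul_mul_assoc] at this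
  have a1 : ∀ j : Fin (n + 2), X (j + 1) j = f ω (Function.update b j (b j * x)) := by
    intro j
    have := hX j.succ j.castSucc
    rw [Fin.val_succ, Fin.val_castSucc] at this
    rw [this, dRaw_castSucc, insX, contract_ins_succ]
  have a2 : ∀ j : Fin (n + 2), X j j = f ω (Function.update b j (x * b j)) := by
    intro j
    have := hX j.castSucc j.castSucc
    rw [Fin.val_castSucc] at this
    rw [this, dRaw_castSucc, insX, contract_ins_self]
  have a3 : X (n + 2) (n + 2) = X 0 0 := by
    have h0 := a2 0
    rw [Fin.val_zero] at h0
    have := hX (Fin.last (n + 2)) (Fin.last (n + 2))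
    rw [Fin.val_last] at this
    rw [this, h0, dRaw_last, insX_last_t D A.fn x hx]
    · simp only [insX, Fin.insertNth_zero]; exact congrArg (f ω) hz
    · intros; exact hf.1 _ _ _
    · intros; exact hf.2.1 _ _ _
    · intro c ω b
      have h1 := hz' 1 b
      rw [one_smul, one_smul] at h1
      rw [hz', h1]
      exact hf.2.2.2 _ _ _ _ _
  simp only [e1, Finset.sum_sub_distrib]
  have a4 : ∑ j ∈ Finset.range (n + 1 + 1), X (j + 1) (j + 1)
      = ∑ j ∈ Finset.range (n + 1 + 1), X j j := by
    rw [Finset.sum_range_succ, a3, Finset.sum_range_succ' (fun j => X j j)]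
  rw [a4, Finset.sum_range, Finset.sum_range]
  simp only [a1, a2, lieX]
  rw [← Finset.sum_sub_distrib]
  refine Finset.sum_congr rfl fun j _ => ?_
  have h1 := hf.2.2.1 ω b j (x * b j) ((-1 : ℂ) • (b j * x))
  rw [hf.2.2.2] at h1
  rw [sub_eq_add_neg (x * b j), ← neg_one_smul ℂ (b j * x), h1]
  ring

end Cartan


section Expo
variable {B : Type} [Ring B] [Algebra ℂ B] {N : ℕ}

/-- the inner derivation -/
def adX (x : B) : B →ₗ[ℂ] B := LinearMap.mulLeft ℂ x - LinearMap.mulRight ℂ x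

theorem adX_apply (x b : B) : adX x b = x * b - b * x := rfl

/-- multilinear functionals -/
abbrev MLF (B : Type) [Ring B] [Algebra ℂ B] (N : ℕ) := MultilinearMap ℂ (fun _ : Fin N => B) ℂ

/-- the inner derivation acting in one slot -/
def del (x : B) (j : Fin N) : Module.End ℂ (MLF B N) :=
  MultilinearMap.compLinearMapₗ (Function.update (fun _ => LinearMap.id) j (adX x))

theorem del_apply (x : B) (j : Fin N) (F : MLF B N) (b : Fin N → B) :
    del x j F b = F (Function.update b j (adX x (b j))) := by
  simp only [del, MultilinearMap.compLinearMapₗ_apply, MultilinearMap.compLinearMap_apply]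
  congr 1
  funext i
  by_cases h : i = j
  · subst h; simp
  · simp [h]

theorem adX_smul (x b : B) (s : ℂ) : adX (s • x) b = s • adX x b := by
  simp [adX_apply, smul_sub]

theorem del_smul (x : B) (s : ℂ) (j : Fin N) : del (s • x) j = s • del x j := by
  ext F b
  simp only [LinearMap.smul_apply, _root_.smul_apply, del_apply, adX_smul,
    MultilinearMap.map_update_smul]

theorem adX_adX {x : B} (hx : x * x = 0) (b : B) : adX x (adX x b) = (-2 : ℂ) • (x * b * x) := by
  simp only [adX_apply, mul_sub, sub_mul, ← mul_assoc, hx, zero_mul]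
  rw [mul_assoc b, hx, neg_smul, two_smul]
  simp
  abel

theorem adX_cube {x : B} (hx : x * x = 0) (b : B) : adX x (adX x (adX x b)) = 0 := by
  rw [adX_adX hx, adX_apply, mul_sub, sub_mul, ← mul_assoc x x, hx]
  have : x * (b * x) * x = 0 := by rw [← mul_assoc, mul_assoc (x * b), hx, mul_zero]
  simp [this]

theorem del_cube {x : B} (hx : x * x = 0) (j : Fin N) : del x j ^ 3 = 0 := by
  ext F b
  simp only [pow_succ, pow_zero, one_mul, Module.End.mul_apply, del_apply, Function.update_self,
    Function.update_idem, adX_cube hx, MultilinearMap.map_update_zero]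
  rfl

theorem del_comm (x : B) (i j : Fin N) : Commute (del x i) (del x j) := by
  by_cases h : i = j
  · subst h; rfl
  · ext F b
    simp only [Module.End.mul_apply, del_apply]
    rw [Function.update_of_ne h, Function.update_of_ne (Ne.symm h), Function.update_comm h]

/-- the Lie derivative on multilinear functionals -/
def lieM (x : B) (S : Finset (Fin N)) : Module.End ℂ (MLF B N) := ∑ j ∈ S, del x j

theorem lieM_nil {x : B} (hx : x * x = 0) (S : Finset (Fin N)) : IsNilpotent (lieM x S) :=
  Commute.isNilpotent_sum (fun j _ => ⟨3, del_cube hx j⟩) fun i j _ _ => del_comm x i j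

theorem conj_expand {x : B} (hx : x * x = 0) (b : B) :
    b + adX x b + (2 : ℂ)⁻¹ • adX x (adX x b) = (1 + x) * b * (1 - x) := by
  rw [adX_adX hx, smul_smul, adX_apply]
  norm_num
  noncomm_ring

theorem exp_del {x : B} (hx : x * x = 0) (j : Fin N) (F : MLF B N) (b : Fin N → B) :
    IsNilpotent.exp (del x j) F b = F (Function.update b j ((1 + x) * b j * (1 - x))) := by
  rw [IsNilpotent.exp_eq_sum (del_cube hx j)]
  have hc : ((2 : ℚ)⁻¹ : ℚ) • (del x j ^ 2 : Module.End ℂ (MLF B N)) = (2 : ℂ)⁻¹ • (del x j ^ 2) := by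
    rw [← Rat.cast_smul_eq_qsmul ℂ]; simp
  have hf2 : ((Nat.factorial 2 : ℕ) : ℚ) = 2 := by norm_num [Nat.factorial]
  simp only [Finset.sum_range_succ, Finset.sum_range_zero, hf2, Nat.factorial_zero,
    Nat.factorial_one, Nat.cast_one, inv_one, one_smul, zero_add, pow_zero, pow_one]
  rw [hc, ← conj_expand hx, MultilinearMap.map_update_add, MultilinearMap.map_update_add,
    MultilinearMap.map_update_smul]
  simp only [LinearMap.add_apply, LinearMap.smul_apply, _root_.add_apply,
    _root_.smul_apply, pow_two, Module.End.mul_apply, del_apply, Function.update_self,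
    Function.update_idem, Function.update_eq_self, Module.End.one_apply]

theorem exp_lie {x : B} (hx : x * x = 0) (S : Finset (Fin N)) (F : MLF B N) (b : Fin N → B) :
    IsNilpotent.exp (lieM x S) F b = F (fun i => if i ∈ S then (1 + x) * b i * (1 - x) else b i) := by
  induction S using Finset.induction_on generalizing F b with
  | empty => simp [lieM, IsNilpotent.exp_zero]
  | insert a S ha ih =>
    have e : lieM x (insert a S) = del x a + lieM x S := by simp [lieM, Finset.sum_insert ha]
    have hcom : Commute (del x a) (lieM x S) :=
      Commute.sum_right _ _ _ fun j _ => del_comm x a j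
    rw [e, IsNilpotent.exp_add_of_commute hcom
      ⟨3, del_cube hx a⟩ (lieM_nil hx S), Module.End.mul_apply, exp_del hx, ih]
    congr 1
    funext i
    by_cases h : i = a
    · subst h; simp [ha]
    · simp [h]

theorem exp_final {x : B} (hx : x * x = 0) : ∃ K : ℕ, ∀ (s : ℂ) (F : MLF B N) (b : Fin N → B),
    F (fun i => (1 + s • x) * b i * (1 - s • x)) =
      ∑ k ∈ Finset.range (K + 1), s ^ k * ((k.factorial : ℂ)⁻¹ * ((lieM x Finset.univ) ^ k) F b) := by
  obtain ⟨K, hK⟩ := lieM_nil (N := N) hx Finset.univ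
  refine ⟨K, fun s F b => ?_⟩
  have hs : (s • x) * (s • x) = 0 := by simp [hx]
  have hl : lieM (N := N) (s • x) Finset.univ = s • lieM x Finset.univ := by
    simp [lieM, del_smul, Finset.smul_sum]
  have h := exp_lie hs Finset.univ F b
  have hK' : (s • lieM (N := N) x Finset.univ) ^ (K + 1) = 0 := by
    rw [smul_pow, pow_succ (lieM x Finset.univ), hK]; simp
  rw [hl, IsNilpotent.exp_eq_sum hK'] at h
  simp only [Finset.mem_univ, if_true] at h
  rw [← h]
  simp only [LinearMap.sum_apply, _root_.sum_apply]
  refine Finset.sum_congr rfl fun k _ => ?_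
  rw [← Rat.cast_smul_eq_qsmul ℂ, smul_pow]
  simp only [LinearMap.smul_apply, _root_.smul_apply, smul_eq_mul]
  push_cast
  ring

/-- a cochain with fixed first argument as a multilinear functional -/
def toMLF {n : ℕ} {f : Raw H B n} (hf : IsML f) (ω : H) : MLF B (n + 1) where
  toFun := f ω
  map_update_add' := by
    intro inst b i x y
    rw [Subsingleton.elim inst (instDecidableEqFin _)]
    exact hf.2.2.1 ω b i x y
  map_update_smul' := by
    intro inst b i x y
    rw [Subsingleton.elim inst (instDecidableEqFin _)]
    exact hf.2.2.2 ω b i x y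

theorem lieX_iter {n : ℕ} {f : Raw H B n} (hf : IsML f) (x : B) (k : ℕ) (ω : H) :
    ((lieX x)^[k] f) ω = ⇑(((lieM x Finset.univ) ^ k) (toMLF hf ω)) := by
  induction k with
  | zero => rfl
  | succ k ih =>
    funext b
    rw [Function.iterate_succ_apply', pow_succ', Module.End.mul_apply]
    simp only [lieX, ih, lieM, LinearMap.sum_apply, _root_.sum_apply, del_apply, adX_apply]

theorem adPull_exp {n : ℕ} {f : Raw H B n} (hf : IsML f) {x : B} (hx : x * x = 0) :
    ∃ K : ℕ, ∀ s : ℂ, adPull (1 + s • x) (1 - s • x) f =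
      ∑ k ∈ Finset.range (K + 1), s ^ k • ((k.factorial : ℂ)⁻¹ • (lieX x)^[k] f) := by
  obtain ⟨K, hK⟩ := exp_final (N := n + 1) hx
  refine ⟨K, fun s => ?_⟩
  funext ω b
  refine (hK s (toMLF hf ω) b).trans ?_
  simp only [Finset.sum_apply, Pi.smul_apply, smul_eq_mul, lieX_iter hf]

theorem vander {V : Type*} [AddCommGroup V] [Module ℂ V] (Z : Submodule ℂ V) (K : ℕ) (v : ℕ → V)
    (h : ∀ s : ℂ, ∑ k ∈ Finset.range K, s ^ k • v k ∈ Z) : ∀ k < K, v k ∈ Z := by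
  intro k hk
  rw [← Submodule.Quotient.mk_eq_zero, ← Module.forall_dual_apply_eq_zero_iff ℂ]
  intro φ
  let p : Polynomial ℂ := ∑ k ∈ Finset.range K, Polynomial.C (φ (Z.mkQ (v k))) * Polynomial.X ^ k
  have hp : p = 0 := by
    apply Polynomial.funext
    intro s
    have := (Submodule.Quotient.mk_eq_zero Z).2 (h s)
    have h2 : φ (Z.mkQ (∑ k ∈ Finset.range K, s ^ k • v k)) = 0 := by
      rw [Submodule.mkQ_apply, this, map_zero]
    simp only [map_sum, map_smul, smul_eq_mul] at h2
    simp only [p, Polynomial.eval_finsetSum, Polynomial.eval_mul, Polynomial.eval_C,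
      Polynomial.eval_pow, Polynomial.eval_X, Polynomial.eval_zero]
    rw [← h2]
    refine Finset.sum_congr rfl fun _ _ => mul_comm _ _
  have := congrArg (fun q => Polynomial.coeff q k) hp
  simp only [p, Polynomial.finsetSum_coeff, Polynomial.coeff_C_mul_X_pow, Polynomial.coeff_zero] at this
  rw [Finset.sum_ite_eq] at this
  simpa [hk] using this

/-- inner automorphisms acting trivially on cyclic cohomology classes -/
def Good {D : HopfData H} (A : MAlg D B) (v v' : B) : Prop :=
  ∀ (n : ℕ) (F : Raw H B (n + 1)), IsCocycle D A.fn F → IsCocycle D A.fn (adPull v v' F) ∧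
    ∃ g : Raw H B n, InC D A.fn g ∧ IsCyc D A.fn g ∧ adPull v v' F = F + bRaw D A.fn g

theorem good_nil {D : HopfData H} (A : MAlg D B) {x : B} (hx : x * x = 0)
    (hi : ∀ ω : H, A.fn ω x = epsi ω • x) : Good A (1 + x) (1 - x) := by
  intro n F hF
  have hc : ∀ s : ℂ, IsCocycle D A.fn (adPull (1 + s • x) (1 - s • x) F) := by
    intro s
    have e : (s • x) * (s • x) = 0 := by simp [hx]
    apply adPull_cocycle A _ _ _ hF
    · rw [add_mul, mul_sub, mul_sub, e]; simp
    · rw [sub_mul, mul_add, mul_add, e]; simp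
    · intro ω
      rw [fn_add, fn_smul, hi, inva_one, smul_add, smul_comm]
  obtain ⟨K, hK⟩ := adPull_exp hF.1.1 hx
  have hz : ∀ k < K + 1, (lieX x)^[k] F ∈ zSub D A.fn (n + 1) := by
    intro k hk
    have := vander (zSub D A.fn (n + 1)) (K + 1) (fun k => (k.factorial : ℂ)⁻¹ • (lieX x)^[k] F)
      (fun s => by rw [← hK, mem_zSub]; exact hc s) k hk
    have h2 := Submodule.smul_mem _ (k.factorial : ℂ) this
    rwa [smul_smul, mul_inv_cancel₀ (by exact_mod_cast k.factorial_ne_zero), one_smul] at h2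
  have h1 := hc 1
  have hK1 := hK 1
  rw [one_smul] at h1 hK1
  refine ⟨h1, ∑ k ∈ Finset.range K, (((k + 1).factorial : ℂ)⁻¹) • psiX x ((lieX x)^[k] F), ?_, ?_, ?_⟩
  · change _ ∈ cSub D A.fn n
    refine Submodule.sum_mem _ fun k hk => Submodule.smul_mem _ _ ?_
    have := hz k (by rw [Finset.mem_range] at hk; omega)
    rw [mem_zSub] at this
    exact psiX_inC A hi this.1
  · change _ ∈ cycSub D A.fn n
    refine Submodule.sum_mem _ fun k hk => Submodule.smul_mem _ _ ?_
    have := hz k (by rw [Finset.mem_range] at hk; omega)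
    rw [mem_zSub] at this
    exact psiX_cyc A hi this.1.1 this.2.1
  · rw [hK1, ← bLin_apply, map_sum, Finset.sum_range_succ',
      add_comm (∑ k ∈ Finset.range K, _) (_ • _)]
    simp only [one_pow, one_smul, Nat.factorial_zero, Nat.cast_one, inv_one,
      Function.iterate_zero, id]
    congr 1
    refine Finset.sum_congr rfl fun k hk => ?_
    have := hz k (by rw [Finset.mem_range] at hk; omega)
    rw [mem_zSub] at this
    rw [map_smul, bLin_apply, cartan A hi this.1.1 this.2.2, Function.iterate_succ_apply']

theorem good_mul {D : HopfData H} (A : MAlg D B) {v v' w w' : B} (hv : Good A v v')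
    (hw : Good A w w') : Good A (v * w) (w' * v') := by
  intro n F hF
  obtain ⟨h1, g, hg, hg', e⟩ := hv n F hF
  obtain ⟨h2, g2, hg2, hg2', e2⟩ := hw n _ h1
  have : adPull (v * w) (w' * v') F = adPull w w' (adPull v v' F) := by
    funext ω b
    simp only [adPull, mul_assoc]
  rw [this]
  refine ⟨h2, g + g2, (cSub D A.fn n).add_mem hg hg2, (cycSub D A.fn n).add_mem hg' hg2', ?_⟩
  rw [e2, e, ← bLin_apply, ← bLin_apply, ← bLin_apply, map_add, add_assoc]

end Expo


section Mat
variable {B : Type} [Ring B] [Algebra ℂ B] {n : ℕ}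

/-- two by two matrices -/
abbrev M2 (B : Type) := Matrix (Fin 2) (Fin 2) B

/-- the entrywise action on matrices -/
def matAct {D : HopfData H} (A : MAlg D B) : MAlg D (M2 B) where
  act := LinearMap.mk₂ ℂ (fun ω (m : M2 B) => m.map (A.fn ω))
    (by intro ω η m; ext i j; simp [fn_add_left])
    (by intro c ω m; ext i j; simp [fn_smul_left])
    (by intro ω m m'; ext i j; simp [fn_add])
    (by intro c ω m; ext i j; simp [fn_smul])
  act_one := by
    ext m i j
    simp [MAlg.fn, RAct.fn, A.act_one]
  act_mul := by
    intro ω η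
    ext m i j
    simp [MAlg.fn, RAct.fn, A.act_mul]
  act_mul_mul := by
    intro ω m m'
    have hl : ∀ (l : List (H × H)) (F : H × H → M2 B) (i j : Fin 2),
        (l.map F).sum i j = (l.map fun p => F p i j).sum := by
      intro l F i j
      induction l with
      | nil => rfl
      | cons a l ih => simp [ih]
    ext i j
    rw [hl]
    simp only [LinearMap.mk₂_apply, Matrix.map_apply, Matrix.mul_apply, Fin.sum_univ_two, fn_add]
    rw [list_sum_add]
    congr 1
    · exact A.act_mul_mul ω _ _
    · exact A.act_mul_mul ω _ _
  act_algOne := by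
    intro ω
    ext i j
    simp only [LinearMap.mk₂_apply, Matrix.map_apply, Matrix.smul_apply, Matrix.one_apply]
    split_ifs
    · exact inva_one A ω
    · rw [fn_zero, smul_zero]

theorem matAct_fn {D : HopfData H} (A : MAlg D B) (ω : H) (m : M2 B) (i j : Fin 2) :
    (matAct A).fn ω m i j = A.fn ω (m i j) := rfl

/-- the entries picked out by a cyclic word -/
def entr (m : Fin (n + 1) → M2 B) (c : Fin (n + 1) → Fin 2) : Fin (n + 1) → B :=
  fun k => m k (c k) (c (k + 1))

/-- the cup product of a cochain with the trace -/
def sharp (f : Raw H B n) : Raw H (M2 B) n := fun ω m => ∑ c : Fin (n + 1) → Fin 2, f ω (entr m c)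

theorem entr_update (m : Fin (n + 1) → M2 B) (c : Fin (n + 1) → Fin 2) (i : Fin (n + 1)) (X : M2 B) :
    entr (Function.update m i X) c = Function.update (entr m c) i (X (c i) (c (i + 1))) := by
  funext k
  by_cases h : k = i
  · subst h; simp [entr]
  · simp [entr, h]

theorem sharp_ml {f : Raw H B n} (hf : IsML f) : IsML (sharp f) := by
  obtain ⟨f1, f2, f3, f4⟩ := hf
  refine ⟨?_, ?_, ?_, ?_⟩
  · intro ω η b; simp only [sharp, f1, Finset.sum_add_distrib]
  · intro ω η b; simp only [sharp, f2, Finset.mul_sum]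
  · intro ω b i x y
    simp only [sharp, entr_update, Matrix.add_apply, f3, Finset.sum_add_distrib]
  · intro ω b i c x
    simp only [sharp, entr_update, Matrix.smul_apply, f4, Finset.mul_sum]

theorem sharp_inv {D : HopfData H} (A : MAlg D B) {f : Raw H B n} (hf : IsInv D A.fn f) :
    IsInv D (matAct A).fn (sharp f) := by
  intro ω η m
  simp only [sharp, Finset.mul_sum]
  rw [list_sum_finset]
  exact Finset.sum_congr rfl fun c _ => hf ω η (entr m c)

theorem sharp_t {D : HopfData H} (A : MAlg D B) (f : Raw H B n) :
    tRaw D (matAct A).fn (sharp f) = sharp (tRaw D A.fn f) := by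
  funext ω m
  simp only [sharp, tRaw]
  rw [list_sum_finset]
  refine Fintype.sum_equiv (Equiv.arrowCongr (Equiv.addRight (1 : Fin (n + 1))).symm (Equiv.refl _))
    _ _ fun c => ?_
  apply list_sum_congr
  intro p
  congr 1
  funext k
  cases k using Fin.cases with
  | zero => simp [entr, matAct_fn, Fin.last_add_one]
  | succ k => simp [entr, matAct_fn]

theorem entr_nat (μ : ℕ → M2 B) (γ : ℕ → Fin 2) :
    entr (fun k : Fin (n + 1) => μ k) (fun k : Fin (n + 1) => γ k)
      = fun k : Fin (n + 1) => μ k (γ k) (γ (if (k : ℕ) = n then 0 else k + 1)) := by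
  funext k
  simp only [entr, Fin.val_add_one]
  congr 2
  simp [Fin.ext_iff]

theorem entr_contract (i : Fin (n + 1)) (m : Fin (n + 2) → M2 B) (c : Fin (n + 1) → Fin 2) (a : Fin 2) :
    contract i (entr m (Fin.insertNth i.succ a c : Fin (n + 2) → Fin 2)) =
      Function.update (entr (contract i m) c) i
        (m i.castSucc (c i) a * m i.succ a (c (i + 1))) := by
  obtain ⟨μ, rfl⟩ := exists_nat_fun m
  obtain ⟨γ, rfl⟩ := exists_nat_fun c
  rw [insertNth_nat]
  have v1 : ∀ k : Fin (n + 1), ((k + 1 : Fin (n + 1)) : ℕ) = if (k : ℕ) = n then (0 : ℕ) else (k : ℕ) + 1 := by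
    intro k
    simp [Fin.val_add_one, Fin.ext_iff]
  have v2 : ∀ k : Fin (n + 2),
      ((k + 1 : Fin (n + 2)) : ℕ) = if (k : ℕ) = n + 1 then (0 : ℕ) else (k : ℕ) + 1 := by
    intro k
    simp [Fin.val_add_one, Fin.ext_iff]
  funext k
  have hk := k.isLt
  have hi := i.isLt
  simp only [Function.update_apply, contract, entr, v1, v2, Fin.val_succ, Fin.val_castSucc,
    Fin.ext_iff]
  rcases lt_trichotomy (k : ℕ) i with h | h | h
  · have h1 : (k : ℕ) < i + 1 := by omega
    have h2 : (k : ℕ) ≠ n + 1 := by omega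
    have h3 : (k : ℕ) ≠ n := by omega
    have h4 : (k : ℕ) + 1 < i + 1 := by omega
    have h5 : (k : ℕ) ≠ i := by omega
    simp only [if_pos h, if_pos h1, if_neg h2, if_neg h3, if_pos h4, if_neg h5]
  · have h2 : (i : ℕ) ≠ n + 1 := by omega
    simp only [h, lt_irrefl, if_true, if_false, if_neg h2, Nat.lt_succ_self]
    have h7 : (if (i : ℕ) + 1 = n + 1 then 0 else (i : ℕ) + 1 + 1)
        = if (i : ℕ) = n then 0 else (i : ℕ) + 1 + 1 := by simp
    rw [h7]
    split_ifs <;> simp_all <;> omega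
  · have h1 : ¬ (k : ℕ) < i := by omega
    have h2 : ¬ (k : ℕ) + 1 < i + 1 := by omega
    have h3 : (k : ℕ) + 1 ≠ i + 1 := by omega
    have h4 : (k : ℕ) ≠ i := by omega
    simp only [if_neg h1, if_neg h2, if_neg h3, if_neg h4, Nat.add_sub_cancel]
    by_cases h5 : (k : ℕ) = n
    · simp [h5]
    · have h6 : (k : ℕ) + 1 ≠ n + 1 := by omega
      have h7 : ¬ (k : ℕ) + 1 + 1 < i + 1 := by omega
      have h8 : (k : ℕ) + 1 + 1 ≠ i + 1 := by omega
      simp only [if_neg h5, if_neg h6, if_neg h7, if_neg h8, Nat.add_sub_cancel]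

theorem sharp_contract {f : Raw H B n} (hf : IsML f) (i : Fin (n + 1)) :
    (fun ω (m : Fin (n + 2) → M2 B) => sharp f ω (contract i m)) =
      sharp fun ω b => f ω (contract i b) := by
  funext ω m
  simp only [sharp]
  rw [← (Fin.insertNthEquiv (fun _ => Fin 2) i.succ).sum_comp, Fintype.sum_prod_type,
    Finset.sum_comm]
  refine Finset.sum_congr rfl fun c _ => ?_
  have hE : ∀ a : Fin 2, f ω (contract i (entr m (Fin.insertNthEquiv (fun _ => Fin 2) i.succ (a, c))))
      = f ω (Function.update (entr (contract i m) c) i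
        (m i.castSucc (c i) a * m i.succ a (c (i + 1)))) := fun a =>
    congrArg (f ω) (entr_contract i m c a)
  simp only [hE]
  have h := (toMLF hf ω).map_update_sum Finset.univ i
    (fun a => m i.castSucc (c i) a * m i.succ a (c (i + 1))) (entr (contract i m) c)
  refine Eq.trans ?_ h
  change f ω _ = f ω _
  congr 1
  rw [← Matrix.mul_apply]
  refine (Function.update_eq_self i (entr (contract i m) c)).symm.trans ?_
  congr 1
  simp [entr, contract]

theorem sharp_d {D : HopfData H} (A : MAlg D B) {f : Raw H B n} (hf : IsML f) (i : Fin (n + 2)) :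
    dRaw D (matAct A).fn i (sharp f) = sharp (dRaw D A.fn i f) := by
  cases i using Fin.lastCases with
  | last => rw [dRaw_last, dRaw_last, sharp_contract hf, sharp_t]
  | cast i => rw [dRaw_castSucc, dRaw_castSucc, sharp_contract hf]

theorem sharp_cocycle {D : HopfData H} (A : MAlg D B) {f : Raw H B n} (hf : IsCocycle D A.fn f) :
    IsCocycle D (matAct A).fn (sharp f) := by
  refine ⟨⟨sharp_ml hf.1.1, sharp_inv A hf.1.2⟩, ?_, ?_⟩
  · intro ω m
    rw [sharp_t]
    simp only [sharp, Finset.mul_sum]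
    exact Finset.sum_congr rfl fun c _ => hf.2.1 ω _
  · intro ω m
    simp only [bRaw, sharp_d A hf.1.1]
    simp only [sharp, Finset.mul_sum]
    rw [Finset.sum_comm]
    exact Finset.sum_eq_zero fun c _ => hf.2.2 ω _

/-- the corner embedding -/
def corner (B : Type) [Ring B] [Algebra ℂ B] : B →ₗ[ℂ] M2 B where
  toFun b := Matrix.single 0 0 b
  map_add' := Matrix.single_add 0 0
  map_smul' c b := by simp [Matrix.smul_single]

theorem pull_sharp {f : Raw H B n} (hf : IsML f) : pull (corner B) (sharp f) = f := by
  funext ω b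
  simp only [pull, sharp]
  rw [Finset.sum_eq_single (fun _ => 0)]
  · congr 1
  · intro c _ hc
    have : ∃ k, c k ≠ 0 := by
      by_contra h
      push Not at h
      exact hc (funext h)
    obtain ⟨k, hk⟩ := this
    refine (toMLF hf ω).map_coord_zero k ?_
    simp only [entr, corner, LinearMap.coe_mk, AddHom.coe_mk]
    exact Matrix.single_apply_of_row_ne (Ne.symm hk) _ _ _
  · simp

theorem good_mat12 {D : HopfData H} (A : MAlg D B) (y : B) (hy : ∀ ω : H, A.fn ω y = epsi ω • y) :
    Good (matAct A) !![1, y; 0, 1] !![1, -y; 0, 1] := by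
  have h := good_nil (matAct A) (x := !![0, y; 0, 0])
    (by ext i j; fin_cases i <;> fin_cases j <;> simp [Matrix.mul_apply])
    (by intro ω; ext i j; rw [matAct_fn]; fin_cases i <;> fin_cases j <;> simp [fn_zero, hy])
  convert h using 1 <;> (ext i j; fin_cases i <;> fin_cases j <;> simp)

theorem good_mat21 {D : HopfData H} (A : MAlg D B) (y : B) (hy : ∀ ω : H, A.fn ω y = epsi ω • y) :
    Good (matAct A) !![1, 0; y, 1] !![1, 0; -y, 1] := by
  have h := good_nil (matAct A) (x := !![0, 0; y, 0])
    (by ext i j; fin_cases i <;> fin_cases j <;> simp [Matrix.mul_apply])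
    (by intro ω; ext i j; rw [matAct_fn]; fin_cases i <;> fin_cases j <;> simp [fn_zero, hy])
  convert h using 1 <;> (ext i j; fin_cases i <;> fin_cases j <;> simp)

theorem inva_neg {D : HopfData H} (A : MAlg D B) {y : B} (hy : ∀ ω : H, A.fn ω y = epsi ω • y) (ω : H) :
    A.fn ω (-y) = epsi ω • (-y) := by
  rw [← neg_one_smul ℂ y, fn_smul, hy, smul_comm]

theorem good_diag {D : HopfData H} (A : MAlg D B) {u u' : B} (huu' : u * u' = 1) (hu'u : u' * u = 1)
    (hu : ∀ ω : H, A.fn ω u = epsi ω • u) : Good (matAct A) !![u, 0; 0, u'] !![u', 0; 0, u] := by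
  have hu' := inva_inverse A huu' hu'u hu
  have h1 := good_mat12 A u hu
  have h2 := good_mat21 A (-u') (inva_neg A hu')
  have h3 := good_mat12 A (-1) (inva_neg A (inva_one A))
  have h4 := good_mat21 A 1 (inva_one A)
  have h := good_mul _ (good_mul _ (good_mul _ h1 h2) h1) (good_mul _ (good_mul _ h3 h4) h3)
  convert h using 1 <;> simp [Matrix.mul_fin_two, huu', hu'u]

theorem corner_fn {D : HopfData H} (A : MAlg D B) (ω : H) (b : B) :
    (matAct A).fn ω (corner B b) = corner B (A.fn ω b) := by
  ext i j
  rw [matAct_fn]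
  fin_cases i <;> fin_cases j <;> simp [corner, fn_zero]

theorem corner_mul (a b : B) : corner B (a * b) = corner B a * corner B b := by
  simp [corner]

theorem corner_conj (u u' b : B) :
    !![u, 0; 0, u'] * corner B b * !![u', 0; 0, u] = corner B (u * b * u') := by
  have e : ∀ b : B, corner B b = !![b, 0; 0, 0] := by
    intro b
    ext i j
    fin_cases i <;> fin_cases j <;> simp [corner]
  rw [e, e]
  simp only [Matrix.mul_fin_two, mul_zero, zero_mul, add_zero, zero_add]

theorem good_all {D : HopfData H} (A : MAlg D B) {u u' : B} (huu' : u * u' = 1) (hu'u : u' * u = 1)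
    (hu : ∀ ω : H, A.fn ω u = epsi ω • u) : Good A u u' := by
  intro n F hF
  refine ⟨adPull_cocycle A huu' hu'u hu hF, ?_⟩
  obtain ⟨-, g, hg, hg', e⟩ := good_diag A huu' hu'u hu n (sharp F) (sharp_cocycle A hF)
  refine ⟨pull (corner B) g, pull_inC D A.fn _ _ (corner_fn A) hg,
    pull_cyc D A.fn _ _ (corner_fn A) hg', ?_⟩
  rw [pull_b D A.fn _ _ (corner_fn A) corner_mul]
  have e2 := congrArg (pull (corner B)) e
  have e3 : pull (corner B) (adPull !![u, 0; 0, u'] !![u', 0; 0, u] (sharp F)) = adPull u u' F := by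
    funext ω b
    simp only [pull, adPull, corner_conj]
    exact congrFun (congrFun (pull_sharp hF.1.1) ω) _
  rw [← e3, e2]
  nth_rewrite 2 [← pull_sharp hF.1.1]
  rfl

theorem deg_zero {D : HopfData H} (A : MAlg D B) {u u' : B} (huu' : u * u' = 1) (hu'u : u' * u = 1)
    (hu : ∀ ω : H, A.fn ω u = epsi ω • u) (f : Raw H B 0) (hf : IsCocycle D A.fn f) :
    adPull u u' f = f := by
  funext ω b
  have hb := hf.2.2 ω (Fin.cons u (fun _ => b 0 * u'))
  have hc := hf.2.1 ω b
  rw [bRaw, Fin.sum_univ_two, show (0 : Fin 2) = Fin.castSucc (0 : Fin 1) from rfl, dRaw_castSucc,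
    show (1 : Fin 2) = Fin.last 1 from rfl, dRaw_last] at hb
  have e0 : contract (0 : Fin 1) (Fin.cons u (fun _ => b 0 * u') : Fin 2 → B)
      = fun i => u * b i * u' := by
    funext i
    rw [show i = 0 from Fin.fin_one_eq_zero i]
    simp [contract, mul_assoc]
  have e1 : tRaw D A.fn (fun ω b => f ω (contract 0 b)) ω (Fin.cons u (fun _ => b 0 * u') : Fin 2 → B)
      = tRaw D A.fn f ω b := by
    simp only [tRaw]
    apply list_sum_congr
    intro p
    congr 1
    funext i
    rw [show i = 0 from Fin.fin_one_eq_zero i]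
    have : A.fn p.2 (b 0 * u') * u = A.fn p.2 (b 0) := by
      rw [← act_mul_inv A hu, mul_assoc, hu'u, mul_one]
    simpa [contract] using this
  beta_reduce at hb
  rw [e0, e1] at hb
  simp only [Fin.val_castSucc, Fin.val_zero, pow_zero, Fin.val_last, pow_one, one_mul] at hb hc
  change f ω (fun i => u * b i * u') = f ω b
  rw [← hc]
  linear_combination hb

end Mat

/-- for an invertible `H`-invariant `u ∈ B`, the automorphism `Ad u`
induces the identity map on the equivariant cyclic cohomology `HC^•_H(B)`
(computed by the cyclic complex `(Ker(1-λ), b)`): the pullback of any cyclic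
cocycle along `Ad u` is again a cyclic cocycle, cohomologous to the original one. -/
theorem inner_automorphism_acts_trivially_on_HC
    {H : Type} [Ring H] [HopfAlgebra ℂ H] (D : HopfData H)
    {B : Type} [Ring B] [Algebra ℂ B] (A : MAlg D B)
    (u u' : B) (huu' : u * u' = 1) (hu'u : u' * u = 1)
    (hinv : ∀ ω : H, A.fn ω u = epsi ω • u) :
    (∀ (n : ℕ) (f : Raw H B (n + 1)), IsCocycle D A.fn f →
      IsCocycle D A.fn (adPull u u' f) ∧
      ∃ g : Raw H B n, InC D A.fn g ∧ IsCyc D A.fn g ∧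
        adPull u u' f = f + bRaw D A.fn g) ∧
    (∀ f : Raw H B 0, IsCocycle D A.fn f → adPull u u' f = f) := by
  exact ⟨good_all A huu' hu'u hinv, deg_zero A huu' hu'u hinv⟩

end
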